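/- For every index i with 1 ≤ i ≤ n−2, OPT(i) = min over all k' with i+1 < k' ≤ n of [ Σ_{m=i}^{k'−2} (v_{m+1} − v_m)^α + OPT(k'−1) − (v_{k'} − v_{k'−1})^α + max( (v_{c} − v_i)^α, (v_{k'} − v_{c})^α ) ], where c = c(i,k') is any index with i < c < k' minimizing |v_c − (v_i + v_{k'})/2| among all indices strictly between i and k'. -/

import Mathlib

/-- Directed edge of the communication graph induced by a left-right assignment
`(ρl, ρr)` on the points with indices in `lo..hi`. -/
def LREdge (v ρl ρr : ℕ → ℝ) (lo hi : ℕ) (a b : ℕ) : Prop :=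
  lo ≤ a ∧ a ≤ hi ∧ lo ≤ b ∧ b ≤ hi ∧
    ((a < b ∧ v b - v a ≤ ρr a) ∨ (b < a ∧ v a - v b ≤ ρl a))

/-- A left-right assignment is valid if its induced graph is strongly connected. -/
def LRValid (v ρl ρr : ℕ → ℝ) (lo hi : ℕ) : Prop :=
  ∀ a b : ℕ, lo ≤ a → a ≤ hi → lo ≤ b → b ≤ hi →
    Relation.ReflTransGen (LREdge v ρl ρr lo hi) a b

/-- `cost(ρl,ρr) = Σ_i (max(ρl(v_i), ρr(v_i)))^α`. -/
noncomputable def LRCost (α : ℝ) (ρl ρr : ℕ → ℝ) (lo hi : ℕ) : ℝ :=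
  ∑ i ∈ Finset.Icc lo hi, (max (ρl i) (ρr i)) ^ α

/-- `OPT(i)`: the infimum of `cost` over all valid left-right assignments for the
points `v_i, ..., v_n` subject to the constraint `ρr(v_i) = v_{i+1} − v_i`. -/
noncomputable def OPT (n : ℕ) (v : ℕ → ℝ) (α : ℝ) (i : ℕ) : ℝ :=
  sInf { c : ℝ | ∃ ρl ρr : ℕ → ℝ, (∀ m, 0 ≤ ρl m) ∧ (∀ m, 0 ≤ ρr m) ∧
    LRValid v ρl ρr i n ∧ ρr i = v (i + 1) - v i ∧ c = LRCost α ρl ρr i n }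

open Finset

/-- Superadditivity of `x ↦ x ^ α` on nonnegative reals, for finite sums. -/
theorem sum_rpow_le_rpow_sum_of_one_le {ι : Type*} (s : Finset ι) (f : ι → ℝ) {α : ℝ}
    (hα : 1 ≤ α) (hf : ∀ m ∈ s, 0 ≤ f m) : ∑ m ∈ s, f m ^ α ≤ (∑ m ∈ s, f m) ^ α := by
  classical
  induction s using Finset.induction_on with
  | empty => simp [Real.zero_rpow (by linarith : α ≠ 0)]
  | insert a s ha ih =>
    rw [sum_insert ha, sum_insert ha]
    have h1 := ih fun m hm => hf m (mem_insert_of_mem hm)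
    have h2 : 0 ≤ ∑ m ∈ s, f m := sum_nonneg fun m hm => hf m (mem_insert_of_mem hm)
    have h3 := Real.add_rpow_le_rpow_add (hf a (mem_insert_self a s)) h2 hα
    linarith

theorem sum_gap_le_of_subset_Ico {v : ℕ → ℝ} {n : ℕ} (hv : StrictMonoOn v (Set.Icc 1 n))
    {a b : ℕ} (ha : 1 ≤ a) (hab : a ≤ b) (hb : b ≤ n) {F : Finset ℕ} (hF : F ⊆ Ico a b) :
    ∑ m ∈ F, (v (m + 1) - v m) ≤ v b - v a := by
  rw [← Finset.sum_Ico_sub v hab]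
  refine sum_le_sum_of_subset_of_nonneg hF fun m hm _ => ?_
  rw [mem_Ico] at hm
  exact sub_nonneg.2 (hv.monotoneOn ⟨by omega, by omega⟩ ⟨by omega, by omega⟩ (by omega))

/-- If every gap in `M` is bridged by one of the segments joining `y ∈ Y` to `p y`, each of
length at most `R y`, then the gaps are paid for by the ranges. -/
theorem sum_gap_rpow_le_of_cover {v : ℕ → ℝ} {n : ℕ} (hv : StrictMonoOn v (Set.Icc 1 n))
    {α : ℝ} (hα : 1 ≤ α) {Y M : Finset ℕ} {p : ℕ → ℕ} {R : ℕ → ℝ}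
    (hY : ∀ y ∈ Y, (1 ≤ y ∧ y ≤ n) ∧ (1 ≤ p y ∧ p y ≤ n) ∧ |v y - v (p y)| ≤ R y)
    (hM : ∀ m ∈ M, ∃ y ∈ Y, min y (p y) ≤ m ∧ m < max y (p y)) :
    ∑ m ∈ M, (v (m + 1) - v m) ^ α ≤ ∑ y ∈ Y, R y ^ α := by
  classical
  choose! f hfY hf1 hf2 using hM
  rw [← sum_fiberwise_of_maps_to (g := f) hfY]
  refine sum_le_sum fun y hy => ?_
  obtain ⟨⟨h1, h2⟩, ⟨h3, h4⟩, h5⟩ := hY y hy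
  have hsub : (M.filter fun m => f m = y) ⊆ Ico (min y (p y)) (max y (p y)) := by
    intro m hm
    rw [mem_filter] at hm
    have := hf1 m hm.1
    have := hf2 m hm.1
    rw [hm.2] at *
    exact mem_Ico.2 ⟨by assumption, by assumption⟩
  have hnn : ∀ m ∈ M.filter fun m => f m = y, 0 ≤ v (m + 1) - v m := by
    intro m hm
    have := mem_Ico.1 (hsub hm)
    exact sub_nonneg.2 (hv.monotoneOn ⟨by omega, by omega⟩ ⟨by omega, by omega⟩ (by omega))
  refine (sum_rpow_le_rpow_sum_of_one_le _ _ hα hnn).trans ?_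
  refine Real.rpow_le_rpow (sum_nonneg hnn) ?_ (by linarith)
  refine (sum_gap_le_of_subset_Ico hv (by omega) (by omega) (by omega) hsub).trans ?_
  rcases le_total y (p y) with h | h
  · rw [max_eq_right h, min_eq_left h]
    linarith [neg_abs_le (v y - v (p y))]
  · rw [max_eq_left h, min_eq_right h]
    linarith [le_abs_self (v y - v (p y))]

theorem exists_edge_leaving {r : ℕ → ℕ → Prop} {a b : ℕ} (h : Relation.ReflTransGen r a b)
    (B : ℕ → Prop) (ha : B a) (hb : ¬ B b) : ∃ s t, B s ∧ ¬ B t ∧ r s t := by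
  induction h with
  | refl => exact absurd ha hb
  | @tail s t _ hst ih =>
    by_cases hs : B s
    · exact ⟨s, t, hs, hb, hst⟩
    · exact ih hs

/-- A shortest-path in-tree: a parent map decreasing the distance to the root `c`. -/
theorem exists_parent_of_reflTransGen {r : ℕ → ℕ → Prop} {V : ℕ → Prop} {c : ℕ}
    (h : ∀ a, V a → Relation.ReflTransGen r a c) (hr : ∀ a b, r a b → V b) :
    ∃ d p : ℕ → ℕ, ∀ y, V y → y ≠ c → r y (p y) ∧ d (p y) < d y := by
  classical
  let S : ℕ → ℕ → Prop := fun k => Nat.rec (fun a => a = c) (fun _ P a => ∃ b, r a b ∧ P b) k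
  have hS : ∀ a, V a → ∃ k, S k a := by
    intro a ha
    induction h a ha using Relation.ReflTransGen.head_induction_on with
    | refl => exact ⟨0, rfl⟩
    | head hab _ ih =>
      obtain ⟨k, hk⟩ := ih (hr _ _ hab)
      exact ⟨k + 1, _, hab, hk⟩
  let d : ℕ → ℕ := fun a => sInf {k | S k a}
  have key : ∀ y, V y → y ≠ c → ∃ b, r y b ∧ d b < d y := by
    intro y hy hyc
    have hmem : S (d y) y := Nat.sInf_mem (s := {k | S k y}) (hS y hy)
    rcases hd : d y with _ | k
    · rw [hd] at hmem
      exact absurd hmem hyc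
    · rw [hd] at hmem
      obtain ⟨b, hb, hk⟩ := hmem
      exact ⟨b, hb, Nat.lt_succ_of_le (Nat.sInf_le hk)⟩
  choose! p hp using key
  exact ⟨d, p, hp⟩

theorem exists_parent_notMem {d p : ℕ → ℕ} {B : Finset ℕ} (hB : B.Nonempty)
    (h : ∀ y ∈ B, d (p y) < d y) : ∃ s ∈ B, p s ∉ B := by
  obtain ⟨s, hs, hmin⟩ := exists_min_image B d hB
  exact ⟨s, hs, fun hps => absurd (hmin _ hps) (not_le.2 (h s hs))⟩

/-- Edges of the graph in which point `a` reaches every point within distance `R a`. -/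
def RangeEdge (v R : ℕ → ℝ) (lo hi a b : ℕ) : Prop :=
  (lo ≤ a ∧ a ≤ hi) ∧ (lo ≤ b ∧ b ≤ hi) ∧ |v a - v b| ≤ R a

theorem lrEdge_of_rangeEdge {v R : ℕ → ℝ} {lo hi a b : ℕ} (h : RangeEdge v R lo hi a b)
    (hab : a ≠ b) : LREdge v R R lo hi a b := by
  obtain ⟨⟨h1, h2⟩, ⟨h3, h4⟩, h5⟩ := h
  refine ⟨h1, h2, h3, h4, ?_⟩
  rw [abs_le] at h5
  rcases lt_or_gt_of_ne hab with h | h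
  · exact Or.inl ⟨h, by linarith⟩
  · exact Or.inr ⟨h, by linarith⟩

theorem reflTransGen_of_rangeEdge {v R : ℕ → ℝ} {lo hi a b : ℕ}
    (h : RangeEdge v R lo hi a b) : Relation.ReflTransGen (LREdge v R R lo hi) a b := by
  by_cases hab : a = b
  · rw [hab]
  · exact .single (lrEdge_of_rangeEdge h hab)

theorem LRCost_nonneg {α : ℝ} {ρl ρr : ℕ → ℝ} (h : ∀ m, 0 ≤ ρl m) (lo hi : ℕ) :
    0 ≤ LRCost α ρl ρr lo hi :=
  sum_nonneg fun m _ => Real.rpow_nonneg ((h m).trans (le_max_left _ _)) _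

theorem OPT_le {n : ℕ} {v : ℕ → ℝ} {α : ℝ} {i : ℕ} {ρl ρr : ℕ → ℝ} (hl : ∀ m, 0 ≤ ρl m)
    (hr : ∀ m, 0 ≤ ρr m) (hval : LRValid v ρl ρr i n) (hi : ρr i = v (i + 1) - v i) :
    OPT n v α i ≤ LRCost α ρl ρr i n := by
  refine csInf_le ⟨0, ?_⟩ ⟨ρl, ρr, hl, hr, hval, hi, rfl⟩
  rintro _ ⟨ρl, ρr, hl, -, -, -, rfl⟩
  exact LRCost_nonneg hl i n

theorem reflTransGen_of_forall_succ {r : ℕ → ℕ → Prop} {a b : ℕ} (hab : a ≤ b)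
    (h : ∀ m, a ≤ m → m < b → Relation.ReflTransGen r m (m + 1)) :
    Relation.ReflTransGen r a b := by
  induction b, hab using Nat.le_induction with
  | base => rfl
  | succ b hb ih => exact (ih fun m h1 h2 => h m h1 (by omega)).trans (h b hb (by omega))

theorem reflTransGen_of_forall_pred {r : ℕ → ℕ → Prop} {a b : ℕ} (hab : a ≤ b)
    (h : ∀ m, a ≤ m → m < b → Relation.ReflTransGen r (m + 1) m) :
    Relation.ReflTransGen r b a := by
  induction b, hab using Nat.le_induction with
  | base => rfl
  | succ b hb ih => exact (h b hb (by omega)).trans (ih fun m h1 h2 => h m h1 (by omega))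

theorem LRValid_of_hub {v ρl ρr : ℕ → ℝ} {lo hi : ℕ} (c : ℕ)
    (h : ∀ a, lo ≤ a → a ≤ hi → Relation.ReflTransGen (LREdge v ρl ρr lo hi) a c ∧
      Relation.ReflTransGen (LREdge v ρl ρr lo hi) c a) : LRValid v ρl ρr lo hi :=
  fun a b ha ha' hb hb' => (h a ha ha').1.trans (h b hb hb').2

theorem exists_valid_assignment {n : ℕ} {v : ℕ → ℝ} (i : ℕ)
    (hi : v i ≤ v (i + 1)) : ∃ ρl ρr : ℕ → ℝ, (∀ m, 0 ≤ ρl m) ∧ (∀ m, 0 ≤ ρr m) ∧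
      LRValid v ρl ρr i n ∧ ρr i = v (i + 1) - v i := by
  refine ⟨fun m => |v m - v (m - 1)|, fun m => |v (m + 1) - v m|, fun _ => abs_nonneg _,
    fun _ => abs_nonneg _, LRValid_of_hub i fun a ha ha' => ⟨?_, ?_⟩,
    abs_of_nonneg (sub_nonneg.2 hi)⟩
  · refine reflTransGen_of_forall_pred ha fun m h1 h2 =>
      .single ⟨by omega, by omega, h1, by omega, ?_⟩
    exact Or.inr ⟨by omega, le_abs_self _⟩
  · refine reflTransGen_of_forall_succ ha fun m h1 h2 =>
      .single ⟨h1, by omega, by omega, by omega, ?_⟩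
    exact Or.inl ⟨by omega, le_abs_self _⟩

theorem OPT_pred_le {n : ℕ} {v : ℕ → ℝ} {α : ℝ} {j : ℕ} (hj : j + 1 = n)
    (hv : v j ≤ v (j + 1)) : OPT n v α j ≤ 2 * (v (j + 1) - v j) ^ α := by
  have h0 : 0 ≤ v (j + 1) - v j := sub_nonneg.2 hv
  have hedge : ∀ a b, (j ≤ a ∧ a ≤ n) → (j ≤ b ∧ b ≤ n) →
      RangeEdge v (fun _ => v (j + 1) - v j) j n a b := by
    intro a b ha hb
    refine ⟨ha, hb, ?_⟩
    rcases (by omega : a = j ∨ a = j + 1) with h | h <;>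
      rcases (by omega : b = j ∨ b = j + 1) with h' | h' <;>
      simp only [h, h'] <;> rw [abs_le] <;> constructor <;> linarith
  refine (OPT_le (fun _ => h0) (fun _ => h0) (fun a b h1 h2 h3 h4 =>
    reflTransGen_of_rangeEdge (hedge a b ⟨h1, h2⟩ ⟨h3, h4⟩)) rfl).trans ?_
  subst hj
  have : j + 1 + 1 - j = 2 := by omega
  simp [LRCost, this]

theorem sum_Icc_eq_add_add_add (f : ℕ → ℝ) {i c j n : ℕ} (hic : i ≤ c) (hcj : c ≤ j)
    (hjn : j ≤ n) : ∑ m ∈ Icc i n, f m =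
      ∑ m ∈ Ico i c, f m + f c + ∑ m ∈ Ico (c + 1) (j + 1), f m +
        ∑ m ∈ Icc (j + 1) n, f m := by
  have e : ∀ a, Icc a n = Ico a (n + 1) := fun a => by ext; simp
  rw [e, e, ← sum_Ico_consecutive f hic (by omega : c ≤ n + 1),
    sum_eq_sum_Ico_succ_bot (by omega : c < n + 1),
    ← sum_Ico_consecutive f (by omega : c + 1 ≤ j + 1) (by omega : j + 1 ≤ n + 1)]
  ring

/-- A hub `c` connecting `i` with `j + 1`, chains of adjacent points between them, and a solution
of the subproblem starting at `j`, combine to a solution of the problem starting at `i`. -/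
theorem OPT_le_of_hub {n : ℕ} {v : ℕ → ℝ} (hv : StrictMonoOn v (Set.Icc 1 n)) {α : ℝ}
    (hα : 1 ≤ α) {i c j : ℕ} (hi : 1 ≤ i) (hic : i < c) (hcj : c ≤ j) (hjn : j < n) :
    OPT n v α i ≤ ∑ m ∈ Ico i j, (v (m + 1) - v m) ^ α + OPT n v α j - (v (j + 1) - v j) ^ α
      + max (v c - v i) (v (j + 1) - v c) ^ α := by
  have hmono : ∀ a b, i ≤ a → a ≤ b → b ≤ n → v a ≤ v b := fun a b ha hab hb =>
    hv.monotoneOn ⟨by omega, by omega⟩ ⟨by omega, by omega⟩ hab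
  set M := max (v c - v i) (v (j + 1) - v c) with hM
  have hM1 : v c - v i ≤ M := le_max_left _ _
  have hM2 : v (j + 1) - v c ≤ M := le_max_right _ _
  have hM0 : 0 ≤ M := (sub_nonneg.2 (hmono i c le_rfl hic.le (by omega))).trans hM1
  suffices h : OPT n v α i - ∑ m ∈ Ico i j, (v (m + 1) - v m) ^ α + (v (j + 1) - v j) ^ α
      - M ^ α ≤ OPT n v α j by linarith
  refine le_csInf ?_ ?_
  · obtain ⟨ρl, ρr, h1, h2, h3, h4⟩ :=
      exists_valid_assignment (n := n) j (hmono j (j + 1) (by omega) (by omega) (by omega))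
    exact ⟨_, ρl, ρr, h1, h2, h3, h4, rfl⟩
  rintro _ ⟨ρl, ρr, hl, hr, hval, hrj, rfl⟩
  let N : ℕ → ℝ := fun m =>
    if m < c then |v (m + 1) - v m| else if m = c then M else |v m - v (m - 1)|
  have hN0 : ∀ m, 0 ≤ N m := by
    intro m
    simp only [N]
    split_ifs <;> positivity
  have hNlt : ∀ m, i ≤ m → m < c → N m = v (m + 1) - v m := by
    intro m h1 h2
    simp only [N, if_pos h2]
    exact abs_of_nonneg (sub_nonneg.2 (hmono m (m + 1) h1 (by omega) (by omega)))
  have hNc : N c = M := by simp [N]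
  have hNgt : ∀ m, c < m → m ≤ n → N m = v m - v (m - 1) := by
    intro m h1 h2
    simp only [N, if_neg (by omega : ¬ m < c), if_neg (by omega : ¬ m = c)]
    exact abs_of_nonneg (sub_nonneg.2 (hmono (m - 1) m (by omega) (by omega) (by omega)))
  let ρl' : ℕ → ℝ := fun m => if m ≤ j then N m else ρl m
  let ρr' : ℕ → ℝ := fun m => if m ≤ j then N m else ρr m
  have hsmall : ∀ a b, i ≤ a → a ≤ j → i ≤ b → b ≤ n → |v a - v b| ≤ N a →
      Relation.ReflTransGen (LREdge v ρl' ρr' i n) a b := by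
    intro a b h1 h2 h3 h4 h5
    rw [abs_le] at h5
    rcases lt_trichotomy a b with h | rfl | h
    · refine .single ⟨h1, by omega, h3, h4, Or.inl ⟨h, ?_⟩⟩
      simp only [ρr', if_pos h2]
      linarith
    · rfl
    · refine .single ⟨h1, by omega, h3, h4, Or.inr ⟨h, ?_⟩⟩
      simp only [ρl', if_pos h2]
      linarith
  have hfrom : ∀ a, i ≤ a → a ≤ j + 1 →
      Relation.ReflTransGen (LREdge v ρl' ρr' i n) c a := by
    intro a h1 h2
    refine hsmall c a hic.le hcj h1 (by omega) ?_
    rw [hNc, abs_le]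
    have := hmono i a le_rfl h1 (by omega)
    have := hmono a (j + 1) h1 h2 (by omega)
    constructor <;> linarith
  have hto : ∀ a, i ≤ a → a ≤ j → Relation.ReflTransGen (LREdge v ρl' ρr' i n) a c := by
    intro a h1 h2
    rcases le_total a c with h | h
    · refine reflTransGen_of_forall_succ h fun m h3 h4 => ?_
      refine hsmall m (m + 1) (by omega) (by omega) (by omega) (by omega) ?_
      rw [hNlt m (by omega) h4, abs_sub_comm, abs_of_nonneg]
      exact sub_nonneg.2 (hmono m (m + 1) (by omega) (by omega) (by omega))
    · refine reflTransGen_of_forall_pred h fun m h3 h4 => ?_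
      refine hsmall (m + 1) m (by omega) (by omega) (by omega) (by omega) ?_
      rw [hNgt (m + 1) (by omega) (by omega), abs_of_nonneg]
      · simp
      · exact sub_nonneg.2 (hmono m (m + 1) (by omega) (by omega) (by omega))
  have hlift : ∀ a b, Relation.ReflTransGen (LREdge v ρl ρr j n) a b →
      Relation.ReflTransGen (LREdge v ρl' ρr' i n) a b := by
    intro a b hab
    induction hab with
    | refl => rfl
    | @tail s t _ hst ih =>
      refine ih.trans ?_
      obtain ⟨h1, h2, h3, h4, h5⟩ := hst
      by_cases hs : s = j
      · subst hs
        have ht : t ≤ s + 1 := by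
          rcases h5 with ⟨h6, h7⟩ | ⟨h6, -⟩
          · by_contra hcon
            have := hv (⟨by omega, by omega⟩ : s + 1 ∈ Set.Icc 1 n)
              (⟨by omega, by omega⟩ : t ∈ Set.Icc 1 n) (by omega)
            linarith
          · omega
        exact (hto s (by omega) le_rfl).trans (hfrom t (by omega) ht)
      · refine .single ⟨by omega, h2, by omega, h4, ?_⟩
        simpa only [ρl', ρr', if_neg (by omega : ¬ s ≤ j)] using h5
  have hvalid : LRValid v ρl' ρr' i n := by
    refine LRValid_of_hub c fun a h1 h2 => ?_
    rcases le_total a j with h | h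
    · exact ⟨hto a h1 h, hfrom a h1 (by omega)⟩
    · exact ⟨(hlift a j (hval a j h h2 le_rfl hjn.le)).trans (hto j (by omega) le_rfl),
        (hfrom j (by omega) (by omega)).trans (hlift j a (hval j a le_rfl hjn.le h h2))⟩
  have hopt := OPT_le (α := α) (ρl := ρl') (ρr := ρr')
    (fun m => by simp only [ρl']; split_ifs <;> [exact hN0 m; exact hl m])
    (fun m => by simp only [ρr']; split_ifs <;> [exact hN0 m; exact hr m]) hvalid
    (by simp only [ρr', if_pos (by omega : i ≤ j)]; exact hNlt i le_rfl hic)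
  refine le_trans ?_ (?_ : (v (j + 1) - v j) ^ α +
    ∑ m ∈ Icc (j + 1) n, max (ρl m) (ρr m) ^ α ≤ _)
  · have hcost : LRCost α ρl' ρr' i n = ∑ m ∈ Ico i j, (v (m + 1) - v m) ^ α + M ^ α +
        ∑ m ∈ Icc (j + 1) n, max (ρl m) (ρr m) ^ α := by
      rw [LRCost, sum_Icc_eq_add_add_add _ hic.le hcj hjn.le]
      have e1 : ∑ m ∈ Ico i c, max (ρl' m) (ρr' m) ^ α =
          ∑ m ∈ Ico i c, (v (m + 1) - v m) ^ α := by
        refine sum_congr rfl fun m hm => ?_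
        rw [mem_Ico] at hm
        simp only [ρl', ρr', if_pos (by omega : m ≤ j), max_self, hNlt m hm.1 hm.2]
      have e2 : ∑ m ∈ Ico (c + 1) (j + 1), max (ρl' m) (ρr' m) ^ α =
          ∑ m ∈ Ico c j, (v (m + 1) - v m) ^ α := by
        rw [← sum_Ico_add']
        refine sum_congr rfl fun m hm => ?_
        rw [mem_Ico] at hm
        simp only [ρl', ρr', if_pos (by omega : m + 1 ≤ j), max_self,
          hNgt (m + 1) (by omega) (by omega), Nat.add_sub_cancel]
      have e3 : ∑ m ∈ Icc (j + 1) n, max (ρl' m) (ρr' m) ^ α =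
          ∑ m ∈ Icc (j + 1) n, max (ρl m) (ρr m) ^ α := by
        refine sum_congr rfl fun m hm => ?_
        rw [mem_Icc] at hm
        simp only [ρl', ρr', if_neg (by omega : ¬ m ≤ j)]
      have e4 : max (ρl' c) (ρr' c) = M := by
        simp only [ρl', ρr', if_pos hcj, max_self, hNc]
      rw [e1, e2, e3, e4, ← sum_Ico_consecutive _ hic.le hcj]
      ring
    linarith
  · rw [LRCost, sum_Icc_eq_add_add_add _ le_rfl le_rfl hjn.le]
    have : (v (j + 1) - v j) ^ α ≤ max (ρl j) (ρr j) ^ α :=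
      Real.rpow_le_rpow (sub_nonneg.2 (hmono j (j + 1) (by omega) (by omega) (by omega)))
        (hrj ▸ le_max_right _ _) (by linarith)
    simpa using this

/-- If every edge from the left of `x` to the right is dominated by an edge from `x`, and some
point right of `x` reaches back to `j`, then the ranges right of `x` together with adjacent gaps
from `j` to `x` solve the subproblem starting at `j`. -/
theorem OPT_le_of_tail {n : ℕ} {v : ℕ → ℝ} (hv : StrictMonoOn v (Set.Icc 1 n)) {α : ℝ}
    {R : ℕ → ℝ} (hR : ∀ m, 0 ≤ R m) {i j x z : ℕ} (hi : 1 ≤ i) (hij : i ≤ j) (hjx : j < x)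
    (hxn : x ≤ n)
    (hS : ∀ a b, i ≤ a → a ≤ n → i ≤ b → b ≤ n →
      Relation.ReflTransGen (RangeEdge v R i n) a b)
    (hx : ∀ s t, s < x → x ≤ t → RangeEdge v R i n s t → |v x - v t| ≤ R x)
    (hxz : x ≤ z) (hzn : z ≤ n) (hz : v z - v j ≤ R z) :
    OPT n v α j ≤ ∑ m ∈ Ico j x, (v (m + 1) - v m) ^ α + ∑ m ∈ Icc x n, R m ^ α := by
  have hmono : ∀ a b, i ≤ a → a ≤ b → b ≤ n → v a ≤ v b := fun a b ha hab hb =>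
    hv.monotoneOn ⟨by omega, by omega⟩ ⟨by omega, by omega⟩ hab
  let R' : ℕ → ℝ := fun m => if m < x then |v (m + 1) - v m| else R m
  have hR'0 : ∀ m, 0 ≤ R' m := by
    intro m
    simp only [R']
    split_ifs <;> [positivity; exact hR m]
  have hR'lt : ∀ m, i ≤ m → m < x → R' m = v (m + 1) - v m := by
    intro m h1 h2
    simp only [R', if_pos h2]
    exact abs_of_nonneg (sub_nonneg.2 (hmono m (m + 1) h1 (by omega) (by omega)))
  have hR'ge : ∀ m, x ≤ m → R' m = R m := fun m h => if_neg (not_lt.2 h)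
  have hchain : ∀ a, j ≤ a → a ≤ x →
      Relation.ReflTransGen (LREdge v R' R' j n) a x := by
    intro a h1 h2
    refine reflTransGen_of_forall_succ h2 fun m h3 h4 => reflTransGen_of_rangeEdge
      ⟨⟨by omega, by omega⟩, ⟨by omega, by omega⟩, ?_⟩
    rw [hR'lt m (by omega) h4, abs_sub_comm, abs_of_nonneg]
    exact sub_nonneg.2 (hmono m (m + 1) (by omega) (by omega) (by omega))
  have hsim : ∀ a b, x ≤ a → a ≤ n → Relation.ReflTransGen (RangeEdge v R i n) a b →
      Relation.ReflTransGen (LREdge v R' R' j n) a (max b x) := by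
    intro a b ha ha' hab
    induction hab with
    | refl => rw [max_eq_left ha]
    | @tail s t _ hst ih =>
      refine ih.trans ?_
      have ⟨⟨h1, h2⟩, ⟨h3, h4⟩, h5⟩ := hst
      rcases lt_or_ge s x with hs | hs <;> rcases lt_or_ge t x with ht | ht
      · rw [max_eq_right hs.le, max_eq_right ht.le]
      · rw [max_eq_right hs.le, max_eq_left ht]
        refine reflTransGen_of_rangeEdge ⟨⟨by omega, hxn⟩, ⟨by omega, h4⟩, ?_⟩
        rw [hR'ge x le_rfl]
        exact hx s t hs ht hst
      · rw [max_eq_left hs, max_eq_right ht.le]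
        refine .trans (b := max t j) ?_ (hchain _ (by omega) (by omega))
        refine reflTransGen_of_rangeEdge ⟨⟨by omega, h2⟩, ⟨by omega, by omega⟩, ?_⟩
        have h6 := hmono t (max t j) h3 (by omega) (by omega)
        have h7 := hmono (max t j) s (by omega) (by omega) h2
        rw [hR'ge s hs]
        rw [abs_le] at h5 ⊢
        constructor <;> linarith
      · rw [max_eq_left hs, max_eq_left ht]
        refine reflTransGen_of_rangeEdge ⟨⟨by omega, h2⟩, ⟨by omega, by omega⟩, ?_⟩
        rw [hR'ge s hs]
        exact h5
  have hvalid : LRValid v R' R' j n := by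
    refine LRValid_of_hub x fun a h1 h2 => ?_
    rcases le_total a x with h | h
    · refine ⟨hchain a h1 h, ?_⟩
      have hxz' := hsim x z le_rfl hxn (hS x z (by omega) hxn (by omega) hzn)
      rw [max_eq_left hxz] at hxz'
      refine hxz'.trans (reflTransGen_of_rangeEdge ⟨⟨by omega, hzn⟩, ⟨h1, h2⟩, ?_⟩)
      have h6 := hmono j a hij h1 h2
      have h7 := hmono a z (by omega) (by omega) hzn
      have := hR z
      rw [hR'ge z hxz, abs_le]
      constructor <;> linarith
    · have h6 := hsim a x h h2 (hS a x (by omega) h2 (by omega) hxn)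
      have h7 := hsim x a le_rfl hxn (hS x a (by omega) hxn (by omega) h2)
      rw [max_self] at h6
      rw [max_eq_left h] at h7
      exact ⟨h6, h7⟩
  refine (OPT_le hR'0 hR'0 hvalid (hR'lt j hij hjx)).trans (le_of_eq ?_)
  have e : ∀ a, Icc a n = Ico a (n + 1) := fun a => by ext; simp
  rw [LRCost, e, e, ← sum_Ico_consecutive _ hjx.le (by omega : x ≤ n + 1)]
  congr 1
  · refine sum_congr rfl fun m hm => ?_
    rw [mem_Ico] at hm
    rw [max_self, hR'lt m (by omega) hm.2]
  · refine sum_congr rfl fun m hm => ?_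
    rw [mem_Ico] at hm
    rw [max_self, hR'ge m hm.1]

/-- Every valid family of ranges contains a hub `c` reaching from `i` to some `j + 1`, and
costs at least as much as the solution that the recurrence builds from `c` and `j`. -/
theorem exists_hub_le_sum_range {n : ℕ} {v : ℕ → ℝ} (hv : StrictMonoOn v (Set.Icc 1 n))
    {α : ℝ} (hα : 1 ≤ α) {R : ℕ → ℝ} (hR : ∀ m, 0 ≤ R m) {i : ℕ} (hi : 1 ≤ i)
    (hin : i + 2 ≤ n) (hRi : R i = v (i + 1) - v i)
    (hS : ∀ a b, i ≤ a → a ≤ n → i ≤ b → b ≤ n →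
      Relation.ReflTransGen (RangeEdge v R i n) a b) :
    ∃ j c, i < j ∧ j < n ∧ i < c ∧ c ≤ j + 1 ∧ v c - v i ≤ R c ∧ v (j + 1) - v c ≤ R c ∧
      ∑ m ∈ Ico i j, (v (m + 1) - v m) ^ α + OPT n v α j - (v (j + 1) - v j) ^ α + R c ^ α
        ≤ ∑ m ∈ Icc i n, R m ^ α := by
  classical
  have hmono : ∀ a b, i ≤ a → a ≤ b → b ≤ n → v a ≤ v b := fun a b ha hab hb =>
    hv.monotoneOn ⟨by omega, by omega⟩ ⟨by omega, by omega⟩ hab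
  -- among the points reaching `i`, take one reaching furthest to the right
  obtain ⟨c, hc, hcmax⟩ : ∃ c ∈ (Ioc i n).filter (fun a => v a - v i ≤ R a),
      ∀ a ∈ (Ioc i n).filter (fun a => v a - v i ≤ R a), v a + R a ≤ v c + R c := by
    refine exists_max_image _ (fun a => v a + R a) ?_
    obtain ⟨s, t, h1, h2, ⟨h3, h3'⟩, -, h5⟩ := exists_edge_leaving
      (hS (i + 1) i (by omega) (by omega) le_rfl (by omega)) (fun a => a ≠ i) (by omega)
      (by simp)
    obtain rfl := not_not.1 h2
    exact ⟨s, mem_filter.2 ⟨mem_Ioc.2 ⟨by omega, h3'⟩, (le_abs_self _).trans h5⟩⟩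
  simp only [mem_filter, mem_Ioc, and_imp] at hc hcmax
  obtain ⟨⟨hic, hcn⟩, hci⟩ := hc
  obtain ⟨d, p, hp⟩ := exists_parent_of_reflTransGen (r := RangeEdge v R i n)
    (V := fun a => i ≤ a ∧ a ≤ n) (c := c)
    (fun a ha => hS a c ha.1 ha.2 hic.le hcn) (fun a b h => h.2.1)
  have hcross : ∀ m, i ≤ m → m < n → ∃ s, (i ≤ s ∧ s ≤ n) ∧ s ≠ c ∧
      (m < c ∧ s ≤ m ∧ m < p s ∨ c ≤ m ∧ m < s ∧ p s ≤ m) := by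
    intro m h1 h2
    rcases lt_or_ge m c with h | h
    · obtain ⟨s, hs, hps⟩ := exists_parent_notMem (d := d) (p := p) (B := Icc i m)
        ⟨i, mem_Icc.2 ⟨le_rfl, h1⟩⟩ (fun y hy => by
          rw [mem_Icc] at hy
          exact (hp y ⟨hy.1, by omega⟩ (by omega)).2)
      rw [mem_Icc] at hs hps
      have := (hp s ⟨hs.1, by omega⟩ (by omega)).1.2.1
      exact ⟨s, ⟨hs.1, by omega⟩, by omega, Or.inl ⟨h, hs.2, by omega⟩⟩
    · obtain ⟨s, hs, hps⟩ := exists_parent_notMem (d := d) (p := p) (B := Icc (m + 1) n)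
        ⟨n, mem_Icc.2 ⟨h2, le_rfl⟩⟩ (fun y hy => by
          rw [mem_Icc] at hy
          exact (hp y ⟨by omega, hy.2⟩ (by omega)).2)
      rw [mem_Icc] at hs hps
      have := (hp s ⟨by omega, hs.2⟩ (by omega)).1.2.1
      exact ⟨s, ⟨by omega, hs.2⟩, by omega, Or.inr ⟨h, by omega, by omega⟩⟩
  rcases le_or_gt (v n) (v c + R c) with hT | hT
  · refine ⟨n - 1, c, by omega, by omega, hic, by omega, hci, ?_, ?_⟩
    · rw [Nat.sub_add_cancel (by omega)]
      linarith
    have hopt := OPT_pred_le (α := α) (n := n) (j := n - 1) (by omega)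
      (hmono (n - 1) (n - 1 + 1) (by omega) (by omega) (by omega))
    have hsum : ∑ m ∈ Ico i n, (v (m + 1) - v m) ^ α ≤ ∑ y ∈ (Icc i n).erase c, R y ^ α := by
      refine sum_gap_rpow_le_of_cover (p := p) hv hα ?_ ?_
      · intro y hy
        rw [mem_erase, mem_Icc] at hy
        obtain ⟨h1, h2, h3⟩ := (hp y hy.2 hy.1).1
        exact ⟨⟨by omega, by omega⟩, ⟨by omega, by omega⟩, h3⟩
      · intro m hm
        rw [mem_Ico] at hm
        obtain ⟨s, h1, h2, h3⟩ := hcross m hm.1 hm.2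
        exact ⟨s, mem_erase.2 ⟨h2, mem_Icc.2 h1⟩, by omega, by omega⟩
    rw [← add_sum_erase _ _ (mem_Icc.2 ⟨hic.le, hcn⟩ : c ∈ Icc i n)]
    have hsplit : ∑ m ∈ Ico i n, (v (m + 1) - v m) ^ α =
        ∑ m ∈ Ico i (n - 1), (v (m + 1) - v m) ^ α + (v (n - 1 + 1) - v (n - 1)) ^ α := by
      rw [← sum_Ico_succ_top (by omega : i ≤ n - 1), Nat.sub_add_cancel (by omega)]
    linarith
  -- the first point within reach of `c` that reaches further right than `c`
  have hX : ∃ x, (i ≤ x ∧ x ≤ n) ∧ v x ≤ v c + R c ∧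
      ∃ b, (i ≤ b ∧ b ≤ n) ∧ v c + R c < v b ∧ v b ≤ v x + R x := by
    obtain ⟨s, t, h1, h2, h3, h4, h5⟩ := exists_edge_leaving
      (hS c n hic.le hcn (by omega) le_rfl) (fun a => v a ≤ v c + R c)
      (by linarith [hR c]) (not_le.2 hT)
    exact ⟨s, h3, h1, t, h4, not_le.1 h2, by linarith [neg_abs_le (v s - v t)]⟩
  let x := Nat.find hX
  obtain ⟨⟨hix, hxn⟩, hxT, b, hb, hbT, hbx⟩ : (i ≤ x ∧ x ≤ n) ∧ v x ≤ v c + R c ∧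
      ∃ b, (i ≤ b ∧ b ≤ n) ∧ v c + R c < v b ∧ v b ≤ v x + R x := Nat.find_spec hX
  have hxmin : ∀ s, s < x → ¬ _ := fun s hs => Nat.find_min hX hs
  have hcx : c < x := by
    by_contra! hxc
    rcases hxc.eq_or_lt with h | h
    · rw [h] at hbx
      linarith
    rcases hix.eq_or_lt with h' | h'
    · rw [← h', hRi] at hbx
      linarith [hmono (i + 1) c (by omega) hic hcn, hR c]
    · by_cases hxi : v x - v i ≤ R x
      · linarith [hcmax x h' hxn hxi]
      · linarith [hmono x c hix hxc hcn]
  have hdom : ∀ s t, s < x → x ≤ t → RangeEdge v R i n s t → |v x - v t| ≤ R x := by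
    rintro s t hs ht ⟨h1, h2, h3⟩
    have h4 : v t ≤ v c + R c := by
      by_contra! h5
      refine hxmin s hs ⟨h1, (hmono s x h1.1 hs.le hxn).trans hxT, t, h2, h5, ?_⟩
      linarith [neg_abs_le (v s - v t)]
    have := hmono x t hix ht h2.2
    rw [abs_le]
    constructor <;> linarith
  -- all gaps left of `x` but one are paid for by the points left of `x` other than `c`
  let Y := (Ico i x).erase c
  let covered : ℕ → Prop := fun m => ∃ y ∈ Y, min y (p y) ≤ m ∧ m < max y (p y)
  have hunc : ∀ m, i ≤ m → m < x → ¬ covered m →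
      c ≤ m ∧ ∃ z, x ≤ z ∧ z ≤ n ∧ v z - v m ≤ R z := by
    intro m h1 h2 h3
    obtain ⟨s, h4, h5, h6⟩ := hcross m h1 (by omega)
    have hsx : x ≤ s := by
      by_contra! hsx
      exact h3 ⟨s, mem_erase.2 ⟨h5, mem_Ico.2 ⟨h4.1, hsx⟩⟩, by omega, by omega⟩
    refine ⟨by omega, s, hsx, h4.2, ?_⟩
    obtain ⟨-, h7, h8⟩ := (hp s h4 h5).1
    linarith [le_abs_self (v s - v (p s)), hmono (p s) m h7.1 (by omega) (by omega)]
  have huniq : ∀ m m', i ≤ m → m < m' → m' < x → ¬ covered m → ¬ covered m' → False := by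
    intro m m' h1 h2 h3 h4 h5
    have hcm := (hunc m h1 (by omega) h4).1
    obtain ⟨s, hs, hps⟩ := exists_parent_notMem (d := d) (p := p) (B := Ioc m m')
      ⟨m', mem_Ioc.2 ⟨h2, le_rfl⟩⟩ (fun y hy => by
        rw [mem_Ioc] at hy
        exact (hp y ⟨by omega, by omega⟩ (by omega)).2)
    rw [mem_Ioc] at hs hps
    have hsY : s ∈ Y := mem_erase.2 ⟨by omega, mem_Ico.2 ⟨by omega, by omega⟩⟩
    rcases le_or_gt (p s) m with h | h
    · exact h4 ⟨s, hsY, by omega, by omega⟩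
    · exact h5 ⟨s, hsY, by omega, by omega⟩
  obtain ⟨j, hcj, hjx, ⟨z, hxz, hzn, hz⟩, hcov⟩ : ∃ j, c ≤ j ∧ j < x ∧
      (∃ z, x ≤ z ∧ z ≤ n ∧ v z - v j ≤ R z) ∧ ∀ m ∈ (Ico i x).erase j, covered m := by
    by_cases hall : ∃ j, i ≤ j ∧ j < x ∧ ¬ covered j
    · obtain ⟨j, h1, h2, h3⟩ := hall
      obtain ⟨h4, h5⟩ := hunc j h1 h2 h3
      refine ⟨j, h4, h2, h5, fun m hm => ?_⟩
      rw [mem_erase, mem_Ico] at hm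
      by_contra h6
      rcases lt_or_gt_of_ne hm.1 with h | h
      · exact huniq m j hm.2.1 h h2 h6 h3
      · exact huniq j m h1 h hm.2.2 h3 h6
    · push Not at hall
      refine ⟨x - 1, by omega, by omega, ?_, fun m hm => ?_⟩
      · obtain ⟨s, t, h1, h2, h3, h4, h5⟩ := exists_edge_leaving
          (hS x i hix hxn le_rfl (by omega)) (fun a => x ≤ a) le_rfl (by omega)
        refine ⟨s, h1, h3.2, ?_⟩
        linarith [le_abs_self (v s - v t), hmono t (x - 1) h4.1 (by omega) (by omega)]
      · rw [mem_erase, mem_Ico] at hm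
        exact hall m hm.2.1 hm.2.2
  have hsum : ∑ m ∈ (Ico i x).erase j, (v (m + 1) - v m) ^ α ≤ ∑ y ∈ Y, R y ^ α := by
    refine sum_gap_rpow_le_of_cover (p := p) hv hα (fun y hy => ?_) hcov
    rw [mem_erase, mem_Ico] at hy
    obtain ⟨h1, h2, h3⟩ := (hp y ⟨hy.2.1, by omega⟩ hy.1).1
    exact ⟨⟨by omega, by omega⟩, ⟨by omega, by omega⟩, h3⟩
  have hopt := OPT_le_of_tail (α := α) hv hR hi (by omega) hjx hxn hS hdom hxz hzn hz
  refine ⟨j, c, ?_, by omega, hic, by omega, hci, ?_, ?_⟩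
  · omega
  · linarith [hmono (j + 1) x (by omega) hjx hxn]
  have e1 := add_sum_erase (Ico i x) (fun m => (v (m + 1) - v m) ^ α)
    (mem_Ico.2 ⟨by omega, hjx⟩ : j ∈ Ico i x)
  have e2 := add_sum_erase (Ico i x) (fun m => R m ^ α)
    (mem_Ico.2 ⟨by omega, hcx⟩ : c ∈ Ico i x)
  have e3 := sum_Ico_consecutive (fun m => (v (m + 1) - v m) ^ α) (by omega : i ≤ j) hjx.le
  have e4 := sum_Ico_consecutive (fun m => R m ^ α) hix (by omega : x ≤ n + 1)
  have e : ∀ a, Icc a n = Ico a (n + 1) := fun a => by ext; simp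
  rw [e] at hopt ⊢
  simp only [Y] at hsum
  linarith

theorem max_sub_le_of_abs_sub_midpoint_le {a b x y R : ℝ}
    (h : |x - (a + b) / 2| ≤ |y - (a + b) / 2|) (h1 : y - a ≤ R) (h2 : b - y ≤ R) :
    max (x - a) (b - x) ≤ R := by
  have h3 : |y - (a + b) / 2| ≤ R - (b - a) / 2 := by
    rw [abs_le]
    constructor <;> linarith
  have h4 := abs_le.1 (h.trans h3)
  rw [max_le_iff]
  constructor <;> linarith

theorem rangeEdge_of_lrEdge {n : ℕ} {v ρl ρr : ℕ → ℝ} (hv : StrictMonoOn v (Set.Icc 1 n))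
    {i a b : ℕ} (hi : 1 ≤ i) (h : LREdge v ρl ρr i n a b) :
    RangeEdge v (fun m => if m = i then ρr i else max (ρl m) (ρr m)) i n a b := by
  obtain ⟨h1, h2, h3, h4, h5⟩ := h
  refine ⟨⟨h1, h2⟩, ⟨h3, h4⟩, ?_⟩
  rcases h5 with ⟨h5, h6⟩ | ⟨h5, h6⟩
  · have := hv (⟨by omega, by omega⟩ : a ∈ Set.Icc 1 n)
      (⟨by omega, by omega⟩ : b ∈ Set.Icc 1 n) h5
    rw [abs_sub_comm, abs_of_pos (sub_pos.2 this)]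
    dsimp only
    split_ifs with h
    · exact h ▸ h6
    · exact h6.trans (le_max_right _ _)
  · have := hv (⟨by omega, by omega⟩ : b ∈ Set.Icc 1 n)
      (⟨by omega, by omega⟩ : a ∈ Set.Icc 1 n) h5
    rw [abs_of_pos (sub_pos.2 this)]
    dsimp only
    rw [if_neg (by omega)]
    exact h6.trans (le_max_left _ _)

/-- The quadratic-time recurrence: for each `k'`, the middle index `k` may be chosen
as any index `c(i,k')` strictly between `i` and `k'` closest to the midpoint of the
segment from `v_i` to `v_{k'}`, so `OPT(i)` is a minimum over `k'` alone. -/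
theorem stmt5 (n : ℕ) (hn : 2 ≤ n) (v : ℕ → ℝ)
    (hv : ∀ m, 1 ≤ m → m < n → v m < v (m + 1))
    (α : ℝ) (hα : 1 ≤ α)
    (i : ℕ) (hi1 : 1 ≤ i) (hi2 : i ≤ n - 2)
    (c : ℕ → ℕ)
    (hc : ∀ k', i + 1 < k' → k' ≤ n →
      i < c k' ∧ c k' < k' ∧
      ∀ m, i < m → m < k' →
        |v (c k') - (v i + v k') / 2| ≤ |v m - (v i + v k') / 2|) :
    OPT n v α i =
      sInf { x : ℝ | ∃ k' : ℕ, i + 1 < k' ∧ k' ≤ n ∧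
        x = (∑ m ∈ Finset.Icc i (k' - 2), (v (m + 1) - v m) ^ α)
            + OPT n v α (k' - 1) - (v k' - v (k' - 1)) ^ α
            + max ((v (c k') - v i) ^ α) ((v k' - v (c k')) ^ α) } := by
  have hvm : StrictMonoOn v (Set.Icc 1 n) := by
    refine strictMonoOn_of_lt_succ Set.ordConnected_Icc fun a _ ha ha' => ?_
    exact hv a ha.1 (Nat.lt_of_succ_le ha'.2)
  have hmono : ∀ a b, i ≤ a → a < b → b ≤ n → v a < v b := fun a b ha hab hb =>
    hvm ⟨by omega, by omega⟩ ⟨by omega, by omega⟩ hab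
  have hform : ∀ j, i < j → j < n →
      (∑ m ∈ Finset.Icc i (j + 1 - 2), (v (m + 1) - v m) ^ α)
            + OPT n v α (j + 1 - 1) - (v (j + 1) - v (j + 1 - 1)) ^ α
            + max ((v (c (j + 1)) - v i) ^ α) ((v (j + 1) - v (c (j + 1))) ^ α) =
      ∑ m ∈ Ico i j, (v (m + 1) - v m) ^ α + OPT n v α j - (v (j + 1) - v j) ^ α
        + max (v (c (j + 1)) - v i) (v (j + 1) - v (c (j + 1))) ^ α := by
    intro j h1 h2
    obtain ⟨h3, h4, -⟩ := hc (j + 1) (by omega) h2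
    have e : Finset.Icc i (j + 1 - 2) = Ico i j := by
      ext
      simp only [Finset.mem_Icc, mem_Ico]
      omega
    rw [e, Nat.add_sub_cancel]
    congr 1
    have h5 : 0 ≤ v (c (j + 1)) - v i := (sub_pos.2 (hmono _ _ le_rfl h3 (by omega))).le
    have h6 : 0 ≤ v (j + 1) - v (c (j + 1)) := (sub_pos.2 (hmono _ _ h3.le h4 h2)).le
    rcases le_total (v (c (j + 1)) - v i) (v (j + 1) - v (c (j + 1))) with h | h
    · rw [max_eq_right h, max_eq_right (Real.rpow_le_rpow h5 h (by linarith))]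
    · rw [max_eq_left h, max_eq_left (Real.rpow_le_rpow h6 h (by linarith))]
  have hupper : ∀ j, i < j → j < n → OPT n v α i ≤
      ∑ m ∈ Ico i j, (v (m + 1) - v m) ^ α + OPT n v α j - (v (j + 1) - v j) ^ α
        + max (v (c (j + 1)) - v i) (v (j + 1) - v (c (j + 1))) ^ α := by
    intro j h1 h2
    obtain ⟨h3, h4, -⟩ := hc (j + 1) (by omega) h2
    exact OPT_le_of_hub hvm hα hi1 h3 (by omega) h2
  apply le_antisymm
  · refine le_csInf ⟨_, n, by omega, le_rfl, rfl⟩ ?_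
    rintro _ ⟨k', h1, h2, rfl⟩
    obtain ⟨j, rfl⟩ : ∃ j, k' = j + 1 := ⟨k' - 1, by omega⟩
    rw [hform j (by omega) h2]
    exact hupper j (by omega) h2
  · refine le_csInf ?_ ?_
    · obtain ⟨ρl, ρr, h1, h2, h3, h4⟩ :=
        exists_valid_assignment (n := n) i (hmono i (i + 1) le_rfl (by omega) (by omega)).le
      exact ⟨_, ρl, ρr, h1, h2, h3, h4, rfl⟩
    rintro _ ⟨ρl, ρr, hl, hr, hval, hri, rfl⟩
    have hedge := fun a b =>
      rangeEdge_of_lrEdge (ρl := ρl) (ρr := ρr) (a := a) (b := b) hvm hi1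
    set R : ℕ → ℝ := fun m => if m = i then ρr i else max (ρl m) (ρr m)
    have hR : ∀ m, 0 ≤ R m := by
      intro m
      simp only [R]
      split_ifs <;> [exact hr i; exact (hl m).trans (le_max_left _ _)]
    obtain ⟨j, k, hij, hjn, hik, hkj, hki, hjk, hle⟩ := exists_hub_le_sum_range hvm hα hR hi1
      (by omega) (by simp only [R, if_pos]; exact hri)
      fun a b h1 h2 h3 h4 => Relation.ReflTransGen.mono hedge _ _ (hval a b h1 h2 h3 h4)
    obtain ⟨h3, h4, h5⟩ := hc (j + 1) (by omega) hjn
    have hmax : max (v (c (j + 1)) - v i) (v (j + 1) - v (c (j + 1))) ≤ R k := by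
      rcases hkj.eq_or_lt with rfl | h
      · have := hmono _ _ le_rfl h3 (by omega)
        have := hmono _ _ h3.le h4 hjn
        rw [max_le_iff]
        constructor <;> linarith
      · exact max_sub_le_of_abs_sub_midpoint_le (h5 k hik h) hki hjk
    have hpow := Real.rpow_le_rpow (le_max_of_le_left
      (sub_pos.2 (hmono _ _ le_rfl h3 (by omega))).le) hmax (by linarith : 0 ≤ α)
    have hcost : ∑ m ∈ Finset.Icc i n, R m ^ α ≤ LRCost α ρl ρr i n := by
      refine sum_le_sum fun m _ => Real.rpow_le_rpow (hR m) ?_ (by linarith)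
      simp only [R]
      split_ifs with h
      · exact h ▸ le_max_right _ _
      · rfl
    refine le_trans (csInf_le ⟨OPT n v α i, ?_⟩ ⟨j + 1, by omega, hjn, rfl⟩) ?_
    · rintro _ ⟨k', h1, h2, rfl⟩
      obtain ⟨j, rfl⟩ : ∃ j, k' = j + 1 := ⟨k' - 1, by omega⟩
      rw [hform j (by omega) h2]
      exact hupper j (by omega) h2
    · rw [hform j hij hjn]
      linarith
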